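/- Let i, l ≥ 2 and j, k, m, n ≥ 1 be integers and ω₁, ω₂ ∈ {I, II, III}. Then ∫_▲ ṽ^{ω₁}_{ijk}(x,y,z) · b̃^{ω₂}_{lmn}(x,y,z) dx dy dz = 0 whenever (i, j, k, ω₁) ≠ (l, m, n, ω₂), and for each ω ∈ {I, II, III} the diagonal value ∫_▲ ṽ^{ω}_{lmn} · b̃^{ω}_{lmn} dx dy dz is nonzero. That is, the auxiliary H(curl) fields on the tetrahedron and the dual candidates b̃^I, b̃^II, b̃^III form a biorthogonal system in L²(▲)³. -/

import Mathlib

open MeasureTheory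

/-- Jacobi polynomial `P_n^{(a,b)}` via the Rodrigues formula (on `(-1,1)`). -/
noncomputable def jacobiP (n a b : ℕ) (x : ℝ) : ℝ :=
  (1 / ((2:ℝ)^n * (Nat.factorial n : ℝ) * (1 - x)^a * (1 + x)^b)) *
    iteratedDeriv n (fun t : ℝ => (1 - t)^a * (1 + t)^b * (t^2 - 1)^n) x

/-- Legendre polynomial `L_n = P_n^{(0,0)}`. -/
noncomputable def legendreP (n : ℕ) (x : ℝ) : ℝ := jacobiP n 0 0 x

/-- Integrated Jacobi polynomial `P̂_n^a(x) = ∫_{-1}^x P_{n-1}^{(a,0)}(t) dt`. -/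
noncomputable def intJacobiP (n a : ℕ) (x : ℝ) : ℝ :=
  ∫ t in (-1:ℝ)..x, jacobiP (n - 1) a 0 t

/-- Integrated Legendre polynomial `L̂_n`. -/
noncomputable def intLegendreP (n : ℕ) (x : ℝ) : ℝ := intJacobiP n 0 x

/-- The open reference tetrahedron with vertices `(-1,-1,-1)`, `(1,-1,-1)`,
`(0,1,-1)`, `(0,0,1)`. -/
def Tet : Set (ℝ × ℝ × ℝ) :=
  {p | -1 < p.2.2 ∧ p.2.2 < 1 ∧ |p.2.1| < (1 - p.2.2) / 2 ∧
       |p.1| < (1 - 2*p.2.1 - p.2.2) / 4}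

/-- Euclidean dot product in `ℝ³`. -/
def dot3 (p q : ℝ × ℝ × ℝ) : ℝ := p.1 * q.1 + p.2.1 * q.2.1 + p.2.2 * q.2.2

/-- The collapsed coordinate `η = 4x/(1-2y-z)`. -/
noncomputable def etaT (p : ℝ × ℝ × ℝ) : ℝ := 4*p.1 / (1 - 2*p.2.1 - p.2.2)

/-- The collapsed coordinate `χ = 2y/(1-z)`. -/
noncomputable def chiT (p : ℝ × ℝ × ℝ) : ℝ := 2*p.2.1 / (1 - p.2.2)

/-- Auxiliary `H(curl)` interior field `ṽ^I_{ijk} = (∇f_i) g_{ij} h_{ijk}` on the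
tetrahedron. -/
noncomputable def vtTetI (i j k : ℕ) (p : ℝ × ℝ × ℝ) : ℝ × ℝ × ℝ :=
  (legendreP (i-1) (etaT p) * (((1 - chiT p)/2)^(i-1) * ((1 - p.2.2)/2)^(i-1) *
      intJacobiP j (2*i) (chiT p) * ((1 - p.2.2)/2)^j * intJacobiP k (2*i+2*j) p.2.2),
   (1/2) * legendreP (i-2) (etaT p) * (((1 - chiT p)/2)^(i-1) * ((1 - p.2.2)/2)^(i-1) *
      intJacobiP j (2*i) (chiT p) * ((1 - p.2.2)/2)^j * intJacobiP k (2*i+2*j) p.2.2),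
   (1/4) * legendreP (i-2) (etaT p) * (((1 - chiT p)/2)^(i-1) * ((1 - p.2.2)/2)^(i-1) *
      intJacobiP j (2*i) (chiT p) * ((1 - p.2.2)/2)^j * intJacobiP k (2*i+2*j) p.2.2))

/-- Auxiliary `H(curl)` interior field `ṽ^II_{ijk} = f_i (∇g_{ij}) h_{ijk}` on the
tetrahedron. -/
noncomputable def vtTetII (i j k : ℕ) (p : ℝ × ℝ × ℝ) : ℝ × ℝ × ℝ :=
  (0,
   jacobiP (j-1) (2*i) 0 (chiT p) * (((1 - p.2.2)/2)^(j-1) * intLegendreP i (etaT p) *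
      ((1 - chiT p)/2)^i * ((1 - p.2.2)/2)^i * intJacobiP k (2*i+2*j) p.2.2),
   ((chiT p/2) * jacobiP (j-1) (2*i) 0 (chiT p) - ((j:ℝ)/2) * intJacobiP j (2*i) (chiT p)) *
     (((1 - p.2.2)/2)^(j-1) * intLegendreP i (etaT p) *
      ((1 - chiT p)/2)^i * ((1 - p.2.2)/2)^i * intJacobiP k (2*i+2*j) p.2.2))

/-- Auxiliary `H(curl)` interior field `ṽ^III_{ijk} = f_i g_{ij} ∇h_{ijk}` on the
tetrahedron. -/
noncomputable def vtTetIII (i j k : ℕ) (p : ℝ × ℝ × ℝ) : ℝ × ℝ × ℝ :=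
  (0, 0,
   jacobiP (k-1) (2*i+2*j) 0 p.2.2 * (intLegendreP i (etaT p) * ((1 - chiT p)/2)^i *
      ((1 - p.2.2)/2)^i * intJacobiP j (2*i) (chiT p) * ((1 - p.2.2)/2)^j))

/-- The auxiliary polynomial `Q^{l,m}_1`. -/
noncomputable def Qtet1 (l m : ℕ) (x : ℝ) : ℝ :=
  jacobiP (m-1) (2*l-1) 1 x + ((m:ℝ) / (2*(l:ℝ) + (m:ℝ) - 1)) * jacobiP (m-1) (2*l) 0 x

/-- The auxiliary polynomial `Q^{l,m}_2`. -/
noncomputable def Qtet2 (l m : ℕ) (x : ℝ) : ℝ :=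
  -(x/2) * jacobiP (m-1) (2*l-1) 1 x +
    ((m:ℝ) / (2*(l:ℝ) + (m:ℝ) - 1)) * ((1 - x)/2) * jacobiP (m-1) (2*l) 0 x

/-- Dual candidate `b̃^I_{lmn}` on the tetrahedron. -/
noncomputable def btTetI (l m n : ℕ) (p : ℝ × ℝ × ℝ) : ℝ × ℝ × ℝ :=
  (legendreP (l-1) (etaT p) * ((1 - chiT p)/2)^(l-1) * jacobiP (m-1) (2*l-1) 1 (chiT p) *
     (((1 - p.2.2)/2)^(l+m-2) * jacobiP (n-1) (2*l+2*m-1) 1 p.2.2),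
   0, 0)

/-- Dual candidate `b̃^II_{lmn}` on the tetrahedron. -/
noncomputable def btTetII (l m n : ℕ) (p : ℝ × ℝ × ℝ) : ℝ × ℝ × ℝ :=
  (((l:ℝ) + 1) * jacobiP (l-1) 1 1 (etaT p) * (((1 - chiT p)/2)^(l-1) *
      jacobiP (m-1) (2*l) 0 (chiT p) * ((1 - p.2.2)/2)^(l+m-2) *
      jacobiP (n-1) (2*l+2*m-1) 1 p.2.2),
   -2*(l:ℝ) * jacobiP (l-2) 1 1 (etaT p) * (((1 - chiT p)/2)^(l-1) *
      jacobiP (m-1) (2*l) 0 (chiT p) * ((1 - p.2.2)/2)^(l+m-2) *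
      jacobiP (n-1) (2*l+2*m-1) 1 p.2.2),
   0)

/-- Dual candidate `b̃^III_{lmn}` on the tetrahedron. -/
noncomputable def btTetIII (l m n : ℕ) (p : ℝ × ℝ × ℝ) : ℝ × ℝ × ℝ :=
  (-(((l:ℝ) + 1) / (2*(l:ℝ))) * jacobiP (l-1) 1 1 (etaT p) * ((1 - chiT p)/2)^(l-1) *
     Qtet1 l m (chiT p) * (((1 - p.2.2)/2)^(l+m-2) * jacobiP (n-1) (2*l+2*m) 0 p.2.2),
   jacobiP (l-2) 1 1 (etaT p) * ((1 - chiT p)/2)^(l-2) * Qtet2 l m (chiT p) *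
     (((1 - p.2.2)/2)^(l+m-2) * jacobiP (n-1) (2*l+2*m) 0 p.2.2),
   jacobiP (l-2) 1 1 (etaT p) * ((1 - chiT p)/2)^(l-2) * jacobiP (m-1) (2*l-1) 1 (chiT p) *
     (((1 - p.2.2)/2)^(l+m-2) * jacobiP (n-1) (2*l+2*m) 0 p.2.2))

/-- The three types of auxiliary `H(curl)` fields / dual candidates. -/
inductive TetType | I | II | III
deriving DecidableEq

/-- The auxiliary `H(curl)` interior fields on the tetrahedron, by type. -/
noncomputable def vtTet : TetType → ℕ → ℕ → ℕ → (ℝ × ℝ × ℝ) → ℝ × ℝ × ℝ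
  | .I => vtTetI
  | .II => vtTetII
  | .III => vtTetIII

/-- The dual candidates on the tetrahedron, by type. -/
noncomputable def btTet : TetType → ℕ → ℕ → ℕ → (ℝ × ℝ × ℝ) → ℝ × ℝ × ℝ
  | .I => btTetI
  | .II => btTetII
  | .III => btTetIII

namespace TetAux
open Polynomial

noncomputable def Ee : ℝ[X] := X ^ 2 - 1
noncomputable def Wt (a b : ℕ) : ℝ[X] := (1 - X) ^ a * (1 + X) ^ b

lemma dW1 (a : ℕ) : derivative ((1 - X : ℝ[X]) ^ a) * (1 - X) = - (a : ℝ[X]) * (1 - X) ^ a := by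
  cases a with
  | zero => simp
  | succ a => rw [derivative_pow_succ]; simp; ring

lemma dW2 (a : ℕ) : derivative ((1 + X : ℝ[X]) ^ a) * (1 + X) = (a : ℝ[X]) * (1 + X) ^ a := by
  cases a with
  | zero => simp
  | succ a => rw [derivative_pow_succ]; simp; ring

lemma dWt (a b : ℕ) : derivative (Wt a b) * Ee = Wt a b * ((a:ℝ[X]) * (1 + X) - (b:ℝ[X]) * (1 - X)) := by
  have h1 := dW1 a
  have h2 := dW2 b
  simp only [Wt, Ee, derivative_mul]
  linear_combination (-(1 + X) ^ b * (1 + X)) * h1 - ((1 - X) ^ a * (1 - X)) * h2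

lemma dvd_step (a b n : ℕ) (p : ℝ[X]) (h : Wt a b * Ee ^ (n + 1) ∣ p) :
    Wt a b * Ee ^ n ∣ derivative p := by
  obtain ⟨q, rfl⟩ := h
  have := dWt a b
  refine ⟨((a:ℝ[X]) * (1 + X) - (b:ℝ[X]) * (1 - X)) * q + ((n:ℝ[X]) + 1) * derivative Ee * q + Ee * derivative q, ?_⟩
  rw [derivative_mul, derivative_mul, derivative_pow_succ]
  simp only [map_add, map_natCast, map_one]
  linear_combination Ee ^ n * q * this

lemma dvd_iter (a b k n : ℕ) (p : ℝ[X]) (h : Wt a b * Ee ^ (k + n) ∣ p) :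
    Wt a b * Ee ^ k ∣ derivative^[n] p := by
  induction n generalizing p with
  | zero => simpa using h
  | succ n ih =>
    rw [Function.iterate_succ_apply]
    exact ih _ (dvd_step a b (k + n) p h)

noncomputable def I (p : ℝ[X]) : ℝ := ∫ x in (-1:ℝ)..1, p.eval x

lemma I_int (p : ℝ[X]) (a b : ℝ) : IntervalIntegrable (fun x => p.eval x) volume a b :=
  p.continuous.intervalIntegrable _ _

lemma I_add (p q : ℝ[X]) : I (p + q) = I p + I q := by
  simp only [I, eval_add]
  exact intervalIntegral.integral_add (I_int _ _ _) (I_int _ _ _)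

lemma I_Cmul (c : ℝ) (p : ℝ[X]) : I (C c * p) = c * I p := by
  simp only [I, eval_mul, eval_C]
  exact intervalIntegral.integral_const_mul _ _

lemma I_sub (p q : ℝ[X]) : I (p - q) = I p - I q := by
  simp only [I, eval_sub]
  exact intervalIntegral.integral_sub (I_int _ _ _) (I_int _ _ _)

lemma I_zero : I 0 = 0 := by simp [I]

lemma int_deriv (p : ℝ[X]) (a b : ℝ) : ∫ x in a..b, (derivative p).eval x = p.eval b - p.eval a :=
  intervalIntegral.integral_eq_sub_of_hasDerivAt (fun x _ => p.hasDerivAt x) (I_int _ _ _)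

lemma I_deriv (p : ℝ[X]) (h1 : p.eval 1 = 0) (h2 : p.eval (-1) = 0) : I (derivative p) = 0 := by
  rw [I, int_deriv, h1, h2, sub_zero]

/-- integration by parts -/
lemma I_parts (p q : ℝ[X]) (h1 : (p * q).eval 1 = 0) (h2 : (p * q).eval (-1) = 0) :
    I (derivative p * q) = - I (p * derivative q) := by
  have := I_deriv (p * q) h1 h2
  rw [derivative_mul, I_add] at this
  linarith

lemma eval_of_dvd (p : ℝ[X]) (h : Ee ∣ p) : p.eval 1 = 0 ∧ p.eval (-1) = 0 := by
  obtain ⟨q, rfl⟩ := h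
  simp [Ee]

lemma I_iter (n : ℕ) (F q : ℝ[X]) (h : Ee ^ n ∣ F) (hq : derivative^[n] q = 0) :
    I (derivative^[n] F * q) = 0 := by
  induction n generalizing q with
  | zero => simp at hq; simp [hq, I_zero]
  | succ n ih =>
    have hd : Ee ∣ derivative^[n] F := by
      have := dvd_iter 0 0 1 n F (by simpa [Wt, add_comm] using h)
      simpa [Wt] using this
    obtain ⟨e1, e2⟩ := eval_of_dvd _ hd
    rw [Function.iterate_succ_apply', I_parts _ _ (by simp [e1]) (by simp [e2]),
      ih (derivative q) ((pow_dvd_pow _ n.le_succ).trans h)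
        (by rwa [Function.iterate_succ_apply] at hq), neg_zero]

noncomputable def Fp (n a b : ℕ) : ℝ[X] := Wt a b * Ee ^ n

lemma Wt_dvd (n a b : ℕ) : Wt a b ∣ derivative^[n] (Fp n a b) := by
  simpa using dvd_iter a b 0 n (Fp n a b) (by simp [Fp])

noncomputable def Jq (n a b : ℕ) : ℝ[X] := (Wt_dvd n a b).choose
noncomputable def J (n a b : ℕ) : ℝ[X] := C (1 / (2 ^ n * (n.factorial : ℝ))) * Jq n a b

lemma Jq_spec (n a b : ℕ) : derivative^[n] (Fp n a b) = Wt a b * Jq n a b :=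
  (Wt_dvd n a b).choose_spec

lemma natDegree_1mX : (1 - X : ℝ[X]).natDegree ≤ 1 := by compute_degree
lemma natDegree_1pX : (1 + X : ℝ[X]).natDegree ≤ 1 := by compute_degree
lemma natDegree_Ee : Ee.natDegree ≤ 2 := by unfold Ee; compute_degree

lemma natDegree_Wt_le (a b : ℕ) : (Wt a b).natDegree ≤ a + b := by
  unfold Wt
  refine natDegree_mul_le_of_le ?_ ?_
  · simpa using natDegree_pow_le_of_le a natDegree_1mX
  · simpa using natDegree_pow_le_of_le b natDegree_1pX

lemma coeff_Wt (a b : ℕ) : (Wt a b).coeff (a + b) = (-1) ^ a := by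
  unfold Wt
  rw [coeff_mul_add_eq_of_natDegree_le]
  · have h1 := coeff_pow_of_natDegree_le (m := a) natDegree_1mX
    have h2 := coeff_pow_of_natDegree_le (m := b) natDegree_1pX
    rw [mul_one] at h1 h2
    rw [h1, h2]
    simp [coeff_one]
  · simpa using natDegree_pow_le_of_le a natDegree_1mX
  · simpa using natDegree_pow_le_of_le b natDegree_1pX

lemma Wt_ne (a b : ℕ) : Wt a b ≠ 0 := by
  intro h
  have := coeff_Wt a b
  rw [h] at this
  simp at this
  have h2 : ((-1:ℝ)) ^ a ≠ 0 := by positivity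
  exact h2 this.symm

lemma natDegree_Wt (a b : ℕ) : (Wt a b).natDegree = a + b := by
  refine le_antisymm (natDegree_Wt_le a b) (le_natDegree_of_ne_zero ?_)
  rw [coeff_Wt]; positivity

lemma natDegree_Fp_le (n a b : ℕ) : (Fp n a b).natDegree ≤ a + b + n * 2 := by
  unfold Fp
  exact natDegree_mul_le_of_le (natDegree_Wt_le a b) (natDegree_pow_le_of_le n natDegree_Ee)

lemma coeff_Fp (n a b : ℕ) : (Fp n a b).coeff (a + b + n * 2) = (-1) ^ a := by
  unfold Fp
  rw [coeff_mul_add_eq_of_natDegree_le (natDegree_Wt_le a b)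
    (natDegree_pow_le_of_le n natDegree_Ee), coeff_Wt,
    coeff_pow_of_natDegree_le natDegree_Ee]
  simp [Ee, coeff_one]

lemma natDegree_Jq (n a b : ℕ) : (Jq n a b).natDegree ≤ n := by
  by_cases h : Jq n a b = 0
  · simp [h]
  have h1 := natDegree_iterate_derivative (Fp n a b) n
  rw [Jq_spec, natDegree_mul (Wt_ne a b) h, natDegree_Wt] at h1
  have := natDegree_Fp_le n a b
  omega

lemma coeff_Jq (n a b : ℕ) : (Jq n a b).coeff n = ((a + b + 2 * n).descFactorial n : ℝ) := by
  have h1 := coeff_iterate_derivative (k := n) (Fp n a b) (a + b + n)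
  rw [Jq_spec, coeff_mul_add_eq_of_natDegree_le (natDegree_Wt_le a b) (natDegree_Jq n a b),
    coeff_Wt, show a + b + n + n = a + b + n * 2 by ring, coeff_Fp, nsmul_eq_mul, mul_comm] at h1
  have h2 : ((-1:ℝ)) ^ a ≠ 0 := by positivity
  rw [mul_comm n 2] at h1
  exact mul_right_cancel₀ h2 h1

lemma natDegree_J (n a b : ℕ) : (J n a b).natDegree ≤ n :=
  (natDegree_C_mul_le _ _).trans (natDegree_Jq n a b)

lemma coeff_J (n a b : ℕ) : (J n a b).coeff n = ((a + b + 2 * n).choose n : ℝ) / 2 ^ n := by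
  rw [J, coeff_C_mul, coeff_Jq, Nat.descFactorial_eq_factorial_mul_choose]
  have : (n.factorial : ℝ) ≠ 0 := by positivity
  push_cast
  field_simp

lemma coeff_J_ne (n a b : ℕ) : (J n a b).coeff n ≠ 0 := by
  rw [coeff_J]
  have : 0 < (a + b + 2 * n).choose n := Nat.choose_pos (by omega)
  positivity

lemma J_ne (n a b : ℕ) : J n a b ≠ 0 := fun h => coeff_J_ne n a b (by simp [h])

lemma Wt_J (n a b : ℕ) :
    Wt a b * J n a b = C (1 / (2 ^ n * (n.factorial : ℝ))) * derivative^[n] (Fp n a b) := by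
  rw [Jq_spec, J]; ring

def LT (n : ℕ) (q : ℝ[X]) : Prop := ∀ m, n ≤ m → q.coeff m = 0

lemma LT.iter {n : ℕ} {q : ℝ[X]} (h : LT n q) : derivative^[n] q = 0 := by
  ext m
  rw [coeff_iterate_derivative, h _ (by omega)]; simp

lemma LT.der {n : ℕ} {q : ℝ[X]} (h : LT (n + 1) q) : LT n (derivative q) := by
  intro m hm
  rw [coeff_derivative, h _ (by omega), zero_mul]

lemma LT.mulp {n : ℕ} {q : ℝ[X]} (h : LT n q) : LT (n + 1) ((1 + X) * q) := by
  intro m hm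
  obtain ⟨m, rfl⟩ : ∃ k, m = k + 1 := ⟨m - 1, by omega⟩
  rw [add_mul, one_mul, coeff_add, coeff_X_mul, h _ (by omega), h _ (by omega), zero_add]

lemma LT.mulm {n : ℕ} {q : ℝ[X]} (h : LT n q) : LT (n + 1) ((1 - X) * q) := by
  intro m hm
  obtain ⟨m, rfl⟩ : ∃ k, m = k + 1 := ⟨m - 1, by omega⟩
  rw [sub_mul, one_mul, coeff_sub, coeff_X_mul, h _ (by omega), h _ (by omega), sub_zero]

lemma LT.of_natDegree {n : ℕ} {q : ℝ[X]} (h : q.natDegree < n) : LT n q :=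
  fun m hm => coeff_eq_zero_of_natDegree_lt (by omega)

lemma LT.add {n : ℕ} {p q : ℝ[X]} (hp : LT n p) (h : LT n q) : LT n (p + q) := by
  intro m hm; rw [coeff_add, hp m hm, h m hm, zero_add]

lemma LT.cmul {n : ℕ} {q : ℝ[X]} (c : ℝ) (h : LT n q) : LT n (C c * q) := by
  intro m hm; rw [coeff_C_mul, h m hm, mul_zero]

lemma orth_aux (n a b : ℕ) (q : ℝ[X]) (hq : LT n q) :
    I (Wt a b * J n a b * q) = 0 := by
  rw [Wt_J, mul_assoc, I_Cmul, I_iter n _ q (by simp [Fp]) hq.iter, mul_zero]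

lemma orth_lt (n a b : ℕ) (q : ℝ[X]) (hq : q.natDegree < n) :
    I (Wt a b * J n a b * q) = 0 :=
  orth_aux n a b q (.of_natDegree hq)

lemma orth (n k a b : ℕ) (h : n ≠ k) : I (Wt a b * J n a b * J k a b) = 0 := by
  rcases lt_or_gt_of_ne h with h | h
  · rw [show Wt a b * J n a b * J k a b = Wt a b * J k a b * J n a b by ring]
    exact orth_lt _ _ _ _ ((natDegree_J n a b).trans_lt h)
  · exact orth_lt _ _ _ _ ((natDegree_J k a b).trans_lt h)

lemma I_sq_pos (a b : ℕ) (q : ℝ[X]) (hq : q ≠ 0) : 0 < I (Wt a b * q * q) := by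
  unfold I
  have hne : Wt a b * q * q ≠ 0 := mul_ne_zero (mul_ne_zero (Wt_ne a b) hq) hq
  have hnn : ∀ x ∈ Set.Icc (-1:ℝ) 1, 0 ≤ (Wt a b * q * q).eval x := by
    intro x hx
    have h1 : 0 ≤ 1 - x := by linarith [hx.2]
    have h2 : 0 ≤ 1 + x := by linarith [hx.1]
    simp only [Wt, eval_mul, eval_pow, eval_sub, eval_add, eval_one, eval_X]
    rw [mul_assoc]
    exact mul_nonneg (by positivity) (mul_self_nonneg _)
  refine intervalIntegral.integral_pos (by norm_num) (Polynomial.continuous _).continuousOn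
    (fun x hx => hnn x ⟨hx.1.le, hx.2⟩) ?_
  by_contra hcon
  push Not at hcon
  apply hne
  apply eq_zero_of_infinite_isRoot
  refine Set.Infinite.mono ?_ (Set.Icc_infinite (show (-1:ℝ) < 1 by norm_num))
  intro x hx
  exact le_antisymm (hcon x hx) (hnn x hx)

/-- uniqueness -/
lemma uniq (n a b : ℕ) (Q : ℝ[X]) (hd : Q.natDegree ≤ n) (c : ℝ)
    (hc : Q.coeff n = c * (J n a b).coeff n)
    (ho : ∀ q : ℝ[X], LT n q → I (Wt a b * Q * q) = 0) : Q = C c * J n a b := by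
  by_contra hne
  set D := Q - C c * J n a b with hD
  have hD0 : D ≠ 0 := sub_ne_zero.mpr hne
  have hDd : D.natDegree ≤ n :=
    (natDegree_sub_le _ _).trans (max_le hd ((natDegree_C_mul_le _ _).trans (natDegree_J n a b)))
  have hDn : D.coeff n = 0 := by simp [hD, hc]
  have hder : LT n D := by
    intro m hm
    rcases hm.eq_or_lt with rfl | hm
    · exact hDn
    · exact coeff_eq_zero_of_natDegree_lt (by omega)
  have h1 := ho D hder
  have h2 := orth_aux n a b D hder
  have h3 := I_sq_pos a b D hD0
  have : Wt a b * D * D = Wt a b * Q * D - C c * (Wt a b * J n a b * D) := by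
    rw [hD]; ring
  rw [this, I_sub, I_Cmul, h1, h2] at h3
  simp at h3

lemma Wt_succ_left (a b : ℕ) : Wt (a + 1) b = (1 - X) * Wt a b := by unfold Wt; ring
lemma Wt_succ_right (a b : ℕ) : Wt a (b + 1) = (1 + X) * Wt a b := by unfold Wt; ring

lemma dWt0 (a : ℕ) : derivative (Wt (a + 1) 0) = - C ((a:ℝ) + 1) * Wt a 0 := by
  simp [Wt, derivative_pow_succ]
  ring

/-- `D((1+x) P_n^{(a,1)}) = (n+1) P_n^{(a+1,0)}` -/
lemma id_plus (n a : ℕ) :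
    derivative ((1 + X) * J n a 1) = C ((n:ℝ) + 1) * J n (a + 1) 0 := by
  have hdeg : ((1 + X) * J n a 1).natDegree ≤ 1 + n :=
    natDegree_mul_le_of_le natDegree_1pX (natDegree_J _ _ _)
  apply uniq
  · exact (natDegree_derivative_le _).trans (by omega)
  · rw [coeff_derivative, add_comm n 1, coeff_mul_add_eq_of_natDegree_le natDegree_1pX
      (natDegree_J _ _ _), coeff_J, coeff_J]
    simp [coeff_one]
    ring
  · intro q hq
    rw [show Wt (a+1) 0 * derivative ((1 + X) * J n a 1) * q =
      derivative ((1 + X) * J n a 1) * (Wt (a+1) 0 * q) by ring, I_parts]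
    · rw [show (1 + X) * J n a 1 * derivative (Wt (a+1) 0 * q) =
        Wt a 1 * J n a 1 * (derivative ((1 - X) * q) + C (-(a:ℝ)) * q) from ?_]
      · rw [orth_aux _ _ _ _ (hq.mulm.der.add (hq.cmul _)), neg_zero]
      · rw [derivative_mul, dWt0, Wt_succ_left, Wt_succ_right]
        simp
        ring
    · simp [Wt]
    · simp [Wt]

lemma id_minus (n a : ℕ) :
    (1 - X) * derivative (J n (a + 1) 0) - C ((a:ℝ) + 1) * J n (a + 1) 0
      = C (-((n:ℝ) + a + 1)) * J n a 1 := by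
  have hd := natDegree_J n (a + 1) 0
  apply uniq
  · refine (natDegree_sub_le _ _).trans (max_le ?_ ((natDegree_C_mul_le _ _).trans hd))
    rcases Nat.eq_zero_or_pos n with rfl | hn
    · rw [natDegree_eq_zero.mp (Nat.le_zero.mp hd) |>.choose_spec.symm]; simp
    · refine (natDegree_mul_le_of_le natDegree_1mX (natDegree_derivative_le _)).trans (by omega)
  · have e : (J n (a+1) 0).coeff (n + 1) = 0 := coeff_eq_zero_of_natDegree_lt (by omega)
    have e2 : (J n (a+1) 0).coeff n = (J n a 1).coeff n := by
      rw [coeff_J, coeff_J, add_zero]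
    rw [sub_mul, one_mul, coeff_sub, coeff_sub, coeff_C_mul, coeff_derivative, e, ← e2]
    cases n with
    | zero => simp; ring
    | succ n => rw [coeff_X_mul, coeff_derivative]; push_cast; ring
  · intro q hq
    rw [show Wt a 1 * ((1 - X) * derivative (J n (a + 1) 0) - C ((a:ℝ) + 1) * J n (a + 1) 0) * q
       = derivative (Wt (a+1) 0 * J n (a + 1) 0) * ((1 + X) * q) from ?_, I_parts]
    · rw [orth_aux _ _ _ _ hq.mulp.der, neg_zero]
    · simp [Wt]
    · simp [Wt]
    · rw [derivative_mul, dWt0, Wt_succ_left, Wt_succ_right]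
      ring

lemma choose_id (n : ℕ) : ((2 * n + 2).choose (n + 1) : ℝ) * (n + 1) =
    ((2 * n + 2).choose n : ℝ) * (n + 2) := by
  have := Nat.choose_succ_right_eq (2 * n + 2) n
  rw [show 2 * n + 2 - n = n + 2 by omega] at this
  exact_mod_cast this

lemma id_leg (n : ℕ) : derivative (J (n + 1) 0 0) = C (((n:ℝ) + 2) / 2) * J n 1 1 := by
  have hd := natDegree_J (n + 1) 0 0
  apply uniq
  · exact (natDegree_derivative_le _).trans (by omega)
  · rw [coeff_derivative, coeff_J, coeff_J]
    have := choose_id n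
    rw [show 0 + 0 + 2 * (n + 1) = 2 * n + 2 by ring, show 1 + 1 + 2 * n = 2 * n + 2 by ring]
    push_cast
    rw [pow_succ]
    linear_combination this / (2 ^ n * 2)
  · intro q hq
    rw [show Wt 1 1 * derivative (J (n + 1) 0 0) * q
       = derivative (J (n + 1) 0 0) * (Wt 1 1 * q) by ring, I_parts]
    · have := orth_aux (n + 1) 0 0 _ hq.mulp.mulm.der
      rw [show J (n + 1) 0 0 * derivative (Wt 1 1 * q) = Wt 0 0 * J (n + 1) 0 0 *
        derivative ((1 - X) * ((1 + X) * q)) by simp [Wt, mul_assoc], this, neg_zero]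
    · simp [Wt]
    · simp [Wt]

lemma id_hat (n : ℕ) : derivative (Ee * J n 1 1) = C (2 * ((n:ℝ) + 1)) * J (n + 1) 0 0 := by
  have hd := natDegree_mul_le_of_le natDegree_Ee (natDegree_J n 1 1)
  apply uniq
  · exact (natDegree_derivative_le _).trans (by omega)
  · rw [coeff_derivative, show n + 1 + 1 = 2 + n by ring,
      coeff_mul_add_eq_of_natDegree_le natDegree_Ee (natDegree_J n 1 1), coeff_J, coeff_J]
    have := choose_id n
    rw [show 0 + 0 + 2 * (n + 1) = 2 * n + 2 by ring, show 1 + 1 + 2 * n = 2 * n + 2 by ring]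
    simp only [Ee, coeff_sub, coeff_X_pow, coeff_one]
    norm_num
    rw [pow_succ]
    linear_combination - this / 2 ^ n
  · intro q hq
    rw [show Wt 0 0 * derivative (Ee * J n 1 1) * q
       = derivative (Ee * J n 1 1) * q by simp [Wt], I_parts]
    · have := orth_aux n 1 1 _ hq.der
      rw [show Ee * J n 1 1 * derivative q = C (-1) * (Wt 1 1 * J n 1 1 * derivative q) by
        simp [Wt, Ee]; ring, I_Cmul, this]; simp
    · simp [Ee]
    · simp [Ee]

/-- norm relation -/
lemma norm_rel (n a : ℕ) : ((n:ℝ) + 1) * I (Wt (a + 1) 0 * J n (a + 1) 0 * J n (a + 1) 0)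
    = ((n:ℝ) + a + 1) * I (Wt a 1 * J n a 1 * J n a 1) := by
  rw [← I_Cmul, ← I_Cmul]
  rw [show C ((n:ℝ) + 1) * (Wt (a + 1) 0 * J n (a + 1) 0 * J n (a + 1) 0) =
    (C ((n:ℝ) + 1) * J n (a + 1) 0) * (Wt (a + 1) 0 * J n (a + 1) 0) by ring, ← id_plus, I_parts]
  · have h := id_minus n a
    rw [show (1 + X) * J n a 1 * derivative (Wt (a + 1) 0 * J n (a + 1) 0) =
      C (-1) * (C ((n:ℝ) + a + 1) * (Wt a 1 * J n a 1 * J n a 1)) from ?_, I_Cmul]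
    · ring
    · rw [derivative_mul, dWt0, Wt_succ_left, Wt_succ_right]
      simp only [C_neg, C_1] at h ⊢
      linear_combination (1 + X) * J n a 1 * Wt a 0 * h
  · simp [Wt]
  · simp [Wt]

lemma eval_iter (c : ℝ) (n : ℕ) (q : ℝ[X]) :
    (derivative^[n] ((X - C c) ^ n * q)).eval c = n.factorial * q.eval c := by
  induction n generalizing q with
  | zero => simp
  | succ n ih =>
    rw [Function.iterate_succ_apply, derivative_mul, derivative_pow_succ]
    rw [show C ((n:ℝ) + 1) * (X - C c) ^ n * derivative (X - C c) * q
      + (X - C c) ^ (n + 1) * derivative q = (X - C c) ^ n * (C ((n:ℝ) + 1) * q +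
        (X - C c) * derivative q) by simp; ring, ih]
    simp [Nat.factorial_succ]
    ring

lemma leg_one (n : ℕ) : (J n 0 0).eval 1 = 1 := by
  have h := Wt_J n 0 0
  have e := eval_iter 1 n ((X + 1) ^ n)
  rw [← mul_pow, show (X - C (1:ℝ)) * (X + 1) = Ee by simp [Ee]; ring] at e
  have : (n.factorial : ℝ) ≠ 0 := by positivity
  simp only [Wt, Fp, pow_zero, one_mul] at h
  rw [h, eval_mul, e]
  simp
  field_simp
  norm_num

lemma leg_neg_one (n : ℕ) : (J n 0 0).eval (-1) = (-1) ^ n := by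
  have h := Wt_J n 0 0
  have e := eval_iter (-1) n ((X - 1) ^ n)
  rw [← mul_pow, show (X - C (-1:ℝ)) * (X - 1) = Ee by simp [Ee]; ring] at e
  have : (n.factorial : ℝ) ≠ 0 := by positivity
  simp only [Wt, Fp, pow_zero, one_mul] at h
  rw [h, eval_mul, e]
  simp
  field_simp
  rw [← mul_pow]
  norm_num

lemma I_parts' (p q : ℝ[X]) :
    I (p * derivative q) = (p * q).eval 1 - (p * q).eval (-1) - I (derivative p * q) := by
  have := int_deriv (p * q) (-1) 1
  change I _ = _ at this
  rw [derivative_mul, I_add] at this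
  linarith

lemma leg_orth (i l : ℕ) (h : i ≤ l) : I (derivative (J i 0 0) * J l 0 0) = 0 := by
  have hd := natDegree_J i 0 0
  rcases Nat.eq_zero_or_pos i with rfl | hi
  · rw [natDegree_eq_zero.mp (Nat.le_zero.mp hd) |>.choose_spec.symm]; simp [I_zero]
  · have := orth_lt l 0 0 (derivative (J i 0 0))
      ((natDegree_derivative_le _).trans_lt (by omega))
    rw [← this]
    congr 1
    simp [Wt, mul_comm]

lemma eta_aux (i l : ℕ) : I (J (i + 1) 0 0 * derivative (J (l + 2) 0 0)) =
    I (J i 0 0 * derivative (J (l + 1) 0 0)) := by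
  by_cases h : i ≤ l + 1
  · rw [I_parts', I_parts', leg_orth _ _ h, leg_orth _ _ (by omega)]
    simp only [eval_mul, leg_one, leg_neg_one]
    ring
  · rw [mul_comm, leg_orth _ _ (by omega), mul_comm, leg_orth _ _ (by omega)]

/-- eta identity -/
lemma eta_id (i l : ℕ) : ((l:ℝ) + 3) * I (J (i + 1) 0 0 * J (l + 1) 1 1) =
    ((l:ℝ) + 2) * I (J i 0 0 * J l 1 1) := by
  have h := eta_aux i l
  rw [id_leg, id_leg, mul_left_comm, I_Cmul, mul_left_comm, I_Cmul] at h
  push_cast at h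
  linarith

lemma Wt_eval_ne (a b : ℕ) (x : ℝ) (h1 : x ≠ 1) (h2 : x ≠ -1 ∨ b = 0) : (Wt a b).eval x ≠ 0 := by
  have h3 : 1 - x ≠ 0 := sub_ne_zero.mpr h1.symm
  simp only [Wt, eval_mul, eval_pow, eval_sub, eval_add, eval_one, eval_X]
  refine mul_ne_zero (pow_ne_zero _ h3) ?_
  rcases h2 with h2 | rfl
  · exact pow_ne_zero _ (fun h => h2 (by linarith))
  · simp

lemma iteratedDeriv_poly (n : ℕ) (p : ℝ[X]) :
    iteratedDeriv n (fun x => p.eval x) = fun x => (derivative^[n] p).eval x := by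
  induction n with
  | zero => simp
  | succ n ih =>
    rw [iteratedDeriv_succ, ih, Function.iterate_succ_apply']
    ext x
    exact Polynomial.deriv _

lemma jacobiP_eq (n a b : ℕ) (x : ℝ) (h1 : x ≠ 1) (h2 : x ≠ -1 ∨ b = 0) :
    jacobiP n a b x = (J n a b).eval x := by
  have hw := Wt_eval_ne a b x h1 h2
  have h := congrArg (eval x) (Wt_J n a b)
  rw [eval_mul, eval_mul, eval_C] at h
  have e : (fun t : ℝ => (1 - t)^a * (1 + t)^b * (t^2 - 1)^n) = fun t => (Fp n a b).eval t := by
    ext t; simp [Fp, Wt, Ee]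
  have ew : (Wt a b).eval x = (1 - x) ^ a * (1 + x) ^ b := by simp [Wt]
  rw [jacobiP, e, iteratedDeriv_poly]
  apply mul_left_cancel₀ hw
  rw [h, ← mul_assoc]
  congr 1
  rw [mul_assoc (_ * _), ← ew]
  have : (n.factorial : ℝ) ≠ 0 := by positivity
  field_simp

lemma intJacobiP_eq (n a : ℕ) (G : ℝ[X]) (hG : derivative G = J (n - 1) a 0)
    (h0 : G.eval (-1) = 0) (x : ℝ) (hx : x ∈ Set.Ioo (-1:ℝ) 1) :
    intJacobiP n a x = G.eval x := by
  rw [intJacobiP, intervalIntegral.integral_congr (g := fun t => (derivative G).eval t),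
    int_deriv, h0, sub_zero]
  intro t ht
  rw [Set.uIcc_of_le hx.1.le] at ht
  simp only [hG]
  exact jacobiP_eq _ _ _ _ (by linarith [ht.2, hx.2] : t < 1).ne (Or.inr rfl)

lemma intJ_eq (n a : ℕ) (x : ℝ) (hx : x ∈ Set.Ioo (-1:ℝ) 1) :
    intJacobiP (n + 1) (a + 1) x = (C (1 / ((n:ℝ) + 1)) * ((1 + X) * J n a 1)).eval x := by
  refine intJacobiP_eq _ _ _ ?_ (by simp) x hx
  have : (n:ℝ) + 1 ≠ 0 := by positivity
  rw [derivative_C_mul, id_plus, ← mul_assoc, ← C_mul]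
  simp [this]

lemma intL_eq (n : ℕ) (x : ℝ) (hx : x ∈ Set.Ioo (-1:ℝ) 1) :
    intLegendreP (n + 2) x = (C (1 / (2 * ((n:ℝ) + 1))) * (Ee * J n 1 1)).eval x := by
  refine intJacobiP_eq _ _ _ ?_ (by simp [Ee]) x hx
  have : 2 * ((n:ℝ) + 1) ≠ 0 := by positivity
  rw [derivative_C_mul, id_hat, ← mul_assoc, ← C_mul, one_div_mul_cancel this]
  simp

end TetAux
namespace TetAux
open Polynomial

def Cube : Set (ℝ × ℝ × ℝ) := Set.Ioo (-1) 1 ×ˢ (Set.Ioo (-1) 1 ×ˢ Set.Ioo (-1) 1)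

noncomputable def Ph (q : ℝ × ℝ × ℝ) : ℝ × ℝ × ℝ :=
  (q.1 * ((1 - q.2.1) / 2) * ((1 - q.2.2) / 2), q.2.1 * ((1 - q.2.2) / 2), q.2.2)

lemma chi_Ph (q : ℝ × ℝ × ℝ) (hq : q ∈ Cube) : chiT (Ph q) = q.2.1 := by
  obtain ⟨h1, h2, h3⟩ := hq
  have : 1 - q.2.2 ≠ 0 := by linarith [h3.2]
  simp only [chiT, Ph]
  field_simp

lemma eta_Ph (q : ℝ × ℝ × ℝ) (hq : q ∈ Cube) : etaT (Ph q) = q.1 := by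
  obtain ⟨h1, h2, h3⟩ := hq
  have a1 : 0 < 1 - q.2.2 := by linarith [h3.2]
  have a2 : 0 < 1 - q.2.1 := by linarith [h2.2]
  have e : 1 - 2 * (q.2.1 * ((1 - q.2.2) / 2)) - q.2.2 = (1 - q.2.1) * (1 - q.2.2) := by ring
  simp only [etaT, Ph]
  rw [e]
  field_simp
  ring

lemma inj_Ph : Set.InjOn Ph Cube := by
  intro p hp q hq h
  have h1 := eta_Ph p hp
  have h2 := chi_Ph p hp
  rw [h, eta_Ph q hq] at h1
  rw [h, chi_Ph q hq] at h2
  have h3 : p.2.2 = q.2.2 := congrArg (fun x => x.2.2) h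
  exact Prod.ext h1.symm (Prod.ext h2.symm h3)

lemma image_Ph : Ph '' Cube = Tet := by
  ext p
  constructor
  · rintro ⟨q, ⟨h1, h2, h3⟩, rfl⟩
    have a1 : 0 < (1 - q.2.2) / 2 := by linarith [h3.2]
    have a2 : 0 < (1 - q.2.1) / 2 := by linarith [h2.2]
    refine ⟨h3.1, h3.2, ?_, ?_⟩
    · simp only [Ph]
      rw [abs_mul, abs_of_pos a1]
      have := abs_lt.mpr h2
      nlinarith
    · simp only [Ph]
      rw [abs_mul, abs_mul, abs_of_pos a1, abs_of_pos a2]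
      have := abs_lt.mpr h1
      have := mul_lt_mul_of_pos_right this (mul_pos a2 a1)
      linarith
  · rintro ⟨h1, h2, h3, h4⟩
    have a1 : 0 < 1 - p.2.2 := by linarith
    have h3' := abs_lt.mp h3
    have h4' := abs_lt.mp h4
    have a2 : 0 < 1 - 2 * p.2.1 - p.2.2 := by linarith [h3'.2]
    refine ⟨(etaT p, chiT p, p.2.2), ⟨?_, ?_, ?_⟩, ?_⟩
    · simp only [etaT]
      constructor
      · rw [lt_div_iff₀ a2]; linarith
      · rw [div_lt_iff₀ a2]; linarith
    · simp only [chiT]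
      constructor
      · rw [lt_div_iff₀ a1]; linarith
      · rw [div_lt_iff₀ a1]; linarith
    · exact ⟨h1, h2⟩
    · have b1 := a1.ne'
      have b2 := a2.ne'
      have e : 1 - chiT p = (1 - 2 * p.2.1 - p.2.2) / (1 - p.2.2) := by
        simp only [chiT]; field_simp; ring
      refine Prod.ext ?_ (Prod.ext ?_ rfl)
      · simp only [Ph]
        rw [e]
        simp only [etaT]
        field_simp
        ring
      · simp only [Ph, chiT]
        field_simp

noncomputable def Pd (q : ℝ × ℝ × ℝ) : (ℝ × ℝ × ℝ) →L[ℝ] (ℝ × ℝ × ℝ) :=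
  let x := ContinuousLinearMap.fst ℝ ℝ (ℝ × ℝ)
  let y := (ContinuousLinearMap.fst ℝ ℝ ℝ).comp (ContinuousLinearMap.snd ℝ ℝ (ℝ × ℝ))
  let z := (ContinuousLinearMap.snd ℝ ℝ ℝ).comp (ContinuousLinearMap.snd ℝ ℝ (ℝ × ℝ))
  (((1 - q.2.1) / 2 * ((1 - q.2.2) / 2)) • x - (q.1 * ((1 - q.2.2) / 2) / 2) • y
      - (q.1 * ((1 - q.2.1) / 2) / 2) • z).prod
    ((((1 - q.2.2) / 2) • y - (q.2.1 / 2) • z).prod z)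

lemma hasF (q : ℝ × ℝ × ℝ) : HasFDerivAt Ph (Pd q) q := by
  have x : HasFDerivAt (fun q : ℝ × ℝ × ℝ => q.1) (ContinuousLinearMap.fst ℝ ℝ (ℝ × ℝ)) q :=
    hasFDerivAt_fst
  have s : HasFDerivAt (fun q : ℝ × ℝ × ℝ => q.2) (ContinuousLinearMap.snd ℝ ℝ (ℝ × ℝ)) q :=
    hasFDerivAt_snd
  have y : HasFDerivAt (fun q : ℝ × ℝ × ℝ => q.2.1) _ q := s.fst
  have z : HasFDerivAt (fun q : ℝ × ℝ × ℝ => q.2.2) _ q := s.snd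
  have y' := (y.const_sub 1).mul_const (1/2)
  have z' := (z.const_sub 1).mul_const (1/2)
  have h := ((x.mul y').mul z').prodMk ((y.mul z').prodMk z)
  have e : Ph = fun q : ℝ × ℝ × ℝ => (q.1 * ((1 - q.2.1) * (1/2)) * ((1 - q.2.2) * (1/2)),
    q.2.1 * ((1 - q.2.2) * (1/2)), q.2.2) := by
    ext q <;> simp only [Ph] <;> ring
  rw [e]
  refine h.congr_fderiv ?_
  symm
  apply ContinuousLinearMap.ext
  intro v
  simp only [Pd]
  refine Prod.ext ?_ (Prod.ext ?_ rfl)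
  · simp; ring
  · simp; ring

noncomputable def B3 : Module.Basis (Fin 3) ℝ (ℝ × ℝ × ℝ) := Module.Basis.ofEquivFun
  { toFun := fun p => ![p.1, p.2.1, p.2.2]
    invFun := fun v => (v 0, v 1, v 2)
    map_add' := by intro p q; ext i; fin_cases i <;> simp
    map_smul' := by intro c p; ext i; fin_cases i <;> simp
    left_inv := by intro p; simp
    right_inv := by intro v; ext i; fin_cases i <;> simp }

lemma det_Pd (q : ℝ × ℝ × ℝ) :
    (Pd q).det = ((1 - q.2.1) / 2) * ((1 - q.2.2) / 2) ^ 2 := by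
  rw [ContinuousLinearMap.det, ← LinearMap.det_toMatrix B3, Matrix.det_fin_three]
  simp [LinearMap.toMatrix_apply, B3, Pd]
  ring

lemma T_int (E Cp Z : ℝ[X]) : IntegrableOn
    (fun q : ℝ × ℝ × ℝ => E.eval q.1 * (Cp.eval q.2.1 * Z.eval q.2.2)) Cube := by
  have hc : Continuous (fun q : ℝ × ℝ × ℝ => E.eval q.1 * (Cp.eval q.2.1 * Z.eval q.2.2)) := by
    fun_prop
  have hk : IsCompact (Set.Icc (-1:ℝ) 1 ×ˢ (Set.Icc (-1:ℝ) 1 ×ˢ Set.Icc (-1:ℝ) 1)) :=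
    isCompact_Icc.prod (isCompact_Icc.prod isCompact_Icc)
  refine (hc.continuousOn.integrableOn_compact hk).mono_set ?_
  exact Set.prod_mono Set.Ioo_subset_Icc_self
    (Set.prod_mono Set.Ioo_subset_Icc_self Set.Ioo_subset_Icc_self)

lemma I_set (p : ℝ[X]) : ∫ x in Set.Ioo (-1:ℝ) 1, p.eval x = I p := by
  rw [I, intervalIntegral.integral_of_le (by norm_num), integral_Ioc_eq_integral_Ioo]

lemma T_val (E Cp Z : ℝ[X]) : ∫ q in Cube, E.eval q.1 * (Cp.eval q.2.1 * Z.eval q.2.2) =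
    I E * (I Cp * I Z) := by
  have h1 := setIntegral_prod_mul (μ := (volume : Measure ℝ)) (ν := (volume : Measure (ℝ × ℝ)))
    (fun x => E.eval x) (fun q : ℝ × ℝ => Cp.eval q.1 * Z.eval q.2)
    (Set.Ioo (-1) 1) (Set.Ioo (-1:ℝ) 1 ×ˢ Set.Ioo (-1:ℝ) 1)
  have h2 := setIntegral_prod_mul (μ := (volume : Measure ℝ)) (ν := (volume : Measure ℝ))
    (fun x => Cp.eval x) (fun x => Z.eval x) (Set.Ioo (-1) 1) (Set.Ioo (-1) 1)
  rw [← Measure.volume_eq_prod] at h1 h2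
  rw [h2, I_set, I_set, I_set] at h1
  exact h1

lemma tet_integral (f : ℝ × ℝ × ℝ → ℝ) (E1 C1 E2 C2 E3 C3 Z : ℝ[X])
    (h : ∀ q ∈ Cube, ((1 - q.2.1) / 2) * ((1 - q.2.2) / 2) ^ 2 * f (Ph q) =
      (E1.eval q.1 * C1.eval q.2.1 + E2.eval q.1 * C2.eval q.2.1 + E3.eval q.1 * C3.eval q.2.1)
        * Z.eval q.2.2) :
    ∫ p in Tet, f p = (I E1 * I C1 + I E2 * I C2 + I E3 * I C3) * I Z := by
  have hm : MeasurableSet Cube :=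
    measurableSet_Ioo.prod (measurableSet_Ioo.prod measurableSet_Ioo)
  have i2 : (volume : Measure (ℝ × ℝ)).IsAddHaarMeasure :=
    inferInstanceAs ((volume : Measure ℝ).prod (volume : Measure ℝ)).IsAddHaarMeasure
  have i3 : (volume : Measure (ℝ × ℝ × ℝ)).IsAddHaarMeasure :=
    inferInstanceAs ((volume : Measure ℝ).prod (volume : Measure (ℝ × ℝ))).IsAddHaarMeasure
  rw [← image_Ph, integral_image_eq_integral_abs_det_fderiv_smul volume hm
    (fun x _ => (hasF x).hasFDerivWithinAt) inj_Ph]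
  rw [setIntegral_congr_fun hm (g := fun q => E1.eval q.1 * (C1.eval q.2.1 * Z.eval q.2.2) +
    E2.eval q.1 * (C2.eval q.2.1 * Z.eval q.2.2) + E3.eval q.1 * (C3.eval q.2.1 * Z.eval q.2.2))]
  · have e := integral_add ((T_int E1 C1 Z).add (T_int E2 C2 Z)) (T_int E3 C3 Z)
    simp only [Pi.add_apply] at e
    rw [e, integral_add (T_int _ _ _) (T_int _ _ _), T_val, T_val, T_val]
    ring
  · intro q hq
    have hq' := hq
    obtain ⟨h1, h2, h3⟩ := hq'
    have a1 : 0 < (1 - q.2.2) / 2 := by linarith [h3.2]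
    have a2 : 0 < (1 - q.2.1) / 2 := by linarith [h2.2]
    simp only [smul_eq_mul]
    rw [det_Pd, abs_of_pos (by positivity), h q hq]
    ring

end TetAux
namespace TetAux
open Polynomial
set_option linter.unusedVariables false
set_option linter.unusedSimpArgs false

noncomputable def U : ℝ[X] := C (1 / 2) * (1 - X)
noncomputable def H (n a : ℕ) : ℝ[X] := C (1 / (n:ℝ)) * ((1 + X) * J (n - 1) (a - 1) 1)
noncomputable def LH (n : ℕ) : ℝ[X] := C (1 / (2 * ((n:ℝ) - 1))) * (Ee * J (n - 2) 1 1)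
noncomputable def Q1 (l m : ℕ) : ℝ[X] :=
  J (m-1) (2*l-1) 1 + C ((m:ℝ) / (2*(l:ℝ) + (m:ℝ) - 1)) * J (m-1) (2*l) 0
noncomputable def Q2 (l m : ℕ) : ℝ[X] :=
  C (-1 / 2) * X * J (m-1) (2*l-1) 1 +
    C ((m:ℝ) / (2*(l:ℝ) + (m:ℝ) - 1)) * U * J (m-1) (2*l) 0

lemma U_eval (x : ℝ) : U.eval x = (1 - x) / 2 := by simp [U]; ring

lemma H_eq (n a : ℕ) (hn : 1 ≤ n) (ha : 1 ≤ a) (x : ℝ) (hx : x ∈ Set.Ioo (-1:ℝ) 1) :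
    intJacobiP n a x = (H n a).eval x := by
  obtain ⟨n, rfl⟩ : ∃ k, n = k + 1 := ⟨n - 1, by omega⟩
  obtain ⟨a, rfl⟩ : ∃ k, a = k + 1 := ⟨a - 1, by omega⟩
  rw [intJ_eq n a x hx, H]
  simp

lemma LH_eq (n : ℕ) (hn : 2 ≤ n) (x : ℝ) (hx : x ∈ Set.Ioo (-1:ℝ) 1) :
    intLegendreP n x = (LH n).eval x := by
  obtain ⟨n, rfl⟩ : ∃ k, n = k + 2 := ⟨n - 2, by omega⟩
  rw [intL_eq n x hx, LH, show ((n + 2 : ℕ) : ℝ) - 1 = (n:ℝ) + 1 by push_cast; ring]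
  simp

lemma P_eq (n a b : ℕ) (x : ℝ) (hx : x ∈ Set.Ioo (-1:ℝ) 1) :
    jacobiP n a b x = (J n a b).eval x := jacobiP_eq _ _ _ _ hx.2.ne (Or.inl hx.1.ne')

lemma orth_iff (n k a b : ℕ) (c : ℝ) (hc : c ≠ 0) :
    I (C c * (Wt a b * J n a b * J k a b)) = 0 ↔ n ≠ k := by
  rw [I_Cmul, mul_eq_zero, or_iff_right hc]
  constructor
  · rintro h rfl
    exact (I_sq_pos a b _ (J_ne n a b)).ne' h
  · exact orth n k a b

lemma eta1 (i l : ℕ) (hi : 2 ≤ i) (hl : 2 ≤ l) :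
    I (J (i-1) 0 0 * J (l-1) 0 0) = 0 ↔ i ≠ l := by
  have := orth_iff (i-1) (l-1) 0 0 1 one_ne_zero
  simp only [Wt, pow_zero, C_1, one_mul] at this
  rw [this]; omega

lemma eta2 (i l : ℕ) (hi : 2 ≤ i) (hl : 2 ≤ l) (c : ℝ) (hc : c ≠ 0) :
    I (LH i * (C c * J (l-2) 1 1)) = 0 ↔ i ≠ l := by
  have h1 : (2:ℝ) ≤ i := by exact_mod_cast hi
  have h2 : (i:ℝ) - 1 ≠ 0 := by linarith
  have := orth_iff (i-2) (l-2) 1 1 (- c * (1 / (2 * ((i:ℝ) - 1)))) (by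
    refine mul_ne_zero (neg_ne_zero.mpr hc) ?_
    exact one_div_ne_zero (mul_ne_zero two_ne_zero h2))
  rw [show LH i * (C c * J (l-2) 1 1) = C (- c * (1 / (2 * ((i:ℝ) - 1)))) *
    (Wt 1 1 * J (i-2) 1 1 * J (l-2) 1 1) by
      simp only [LH, Wt, Ee, C_mul, C_neg]; ring, this]
  omega

lemma U_pow (n : ℕ) : U ^ n = C ((1 / 2 : ℝ) ^ n) * Wt n 0 := by
  rw [U, Wt, mul_pow, C_pow, pow_zero, mul_one]

lemma Wt_one (n : ℕ) : Wt n 1 = Wt n 0 * (1 + X) := by simp [Wt]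

/-- weights with hat -/
lemma hatI (e n a k : ℕ) (hn : 1 ≤ n) (hk : 1 ≤ k) (he : e = a - 1) :
    I (U ^ e * (H n a * J (k-1) (a-1) 1)) = 0 ↔ n ≠ k := by
  have h2 : (n:ℝ) ≠ 0 := by positivity
  have := orth_iff (n-1) (k-1) (a-1) 1 ((1/2:ℝ)^e * (1 / (n:ℝ))) (by positivity)
  rw [show U ^ e * (H n a * J (k-1) (a-1) 1) = C ((1/2:ℝ)^e * (1 / (n:ℝ))) *
    (Wt (a-1) 1 * J (n-1) (a-1) 1 * J (k-1) (a-1) 1) by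
      rw [U_pow, Wt_one, H, he, C_mul]; ring, this]
  omega

lemma hatII (e n a k : ℕ) (hn : 1 ≤ n) (hk : 1 ≤ k) (he : e = a) :
    I (U ^ e * (J (n-1) a 0 * J (k-1) a 0)) = 0 ↔ n ≠ k := by
  have := orth_iff (n-1) (k-1) a 0 ((1/2:ℝ)^e) (by positivity)
  rw [show U ^ e * (J (n-1) a 0 * J (k-1) a 0) = C ((1/2:ℝ)^e) *
    (Wt a 0 * J (n-1) a 0 * J (k-1) a 0) by
      rw [U_pow, he]; ring, this]
  omega

section vals
variable (i j k l m n : ℕ)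

lemma val_I_I (hi : 2 ≤ i) (hl : 2 ≤ l) (hj : 1 ≤ j) (hk : 1 ≤ k) (hm : 1 ≤ m) (hn : 1 ≤ n) :
    ∫ p in Tet, dot3 (vtTetI i j k p) (btTetI l m n p) =
      (I (J (i-1) 0 0 * J (l-1) 0 0) *
        I (U ^ ((i-1) + (l-1) + 1) * (H j (2*i) * J (m-1) (2*l-1) 1))) *
      I (U ^ ((i-1) + j + (l+m-2) + 2) * (H k (2*i+2*j) * J (n-1) (2*l+2*m-1) 1)) := by
  rw [tet_integral _ (J (i-1) 0 0 * J (l-1) 0 0)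
    (U ^ ((i-1) + (l-1) + 1) * (H j (2*i) * J (m-1) (2*l-1) 1)) 0 0 0 0
    (U ^ ((i-1) + j + (l+m-2) + 2) * (H k (2*i+2*j) * J (n-1) (2*l+2*m-1) 1))]
  · simp [I_zero]
  · intro q hq
    obtain ⟨h1, h2, h3⟩ := id hq
    simp only [dot3, vtTetI, btTetI, eta_Ph q hq, chi_Ph q hq, show (Ph q).2.2 = q.2.2 from rfl,
      legendreP, P_eq _ _ _ _ h1, P_eq _ _ _ _ h2, P_eq _ _ _ _ h3,
      H_eq j (2*i) hj (by omega) _ h2, H_eq k (2*i+2*j) hk (by omega) _ h3,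
      eval_mul, eval_pow, U_eval, eval_zero]
    ring

lemma val_II_II (hi : 2 ≤ i) (hl : 2 ≤ l) (hj : 1 ≤ j) (hk : 1 ≤ k) (hm : 1 ≤ m) (hn : 1 ≤ n) :
    ∫ p in Tet, dot3 (vtTetII i j k p) (btTetII l m n p) =
      (I (LH i * (C (-2 * (l:ℝ)) * J (l-2) 1 1)) *
        I (U ^ (i + (l-1) + 1) * (J (j-1) (2*i) 0 * J (m-1) (2*l) 0))) *
      I (U ^ ((j-1) + i + (l+m-2) + 2) * (H k (2*i+2*j) * J (n-1) (2*l+2*m-1) 1)) := by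
  rw [tet_integral _ (LH i * (C (-2 * (l:ℝ)) * J (l-2) 1 1))
    (U ^ (i + (l-1) + 1) * (J (j-1) (2*i) 0 * J (m-1) (2*l) 0)) 0 0 0 0
    (U ^ ((j-1) + i + (l+m-2) + 2) * (H k (2*i+2*j) * J (n-1) (2*l+2*m-1) 1))]
  · simp [I_zero]
  · intro q hq
    obtain ⟨h1, h2, h3⟩ := id hq
    simp only [dot3, vtTetII, btTetII, eta_Ph q hq, chi_Ph q hq, show (Ph q).2.2 = q.2.2 from rfl,
      legendreP, P_eq _ _ _ _ h1, P_eq _ _ _ _ h2, P_eq _ _ _ _ h3, LH_eq i hi _ h1,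
      H_eq j (2*i) hj (by omega) _ h2, H_eq k (2*i+2*j) hk (by omega) _ h3,
      eval_mul, eval_pow, U_eval, eval_zero, eval_C]
    ring

lemma val_III_III (hi : 2 ≤ i) (hl : 2 ≤ l) (hj : 1 ≤ j) (hk : 1 ≤ k) (hm : 1 ≤ m) (hn : 1 ≤ n) :
    ∫ p in Tet, dot3 (vtTetIII i j k p) (btTetIII l m n p) =
      (I (LH i * (C 1 * J (l-2) 1 1)) *
        I (U ^ (i + (l-2) + 1) * (H j (2*i) * J (m-1) (2*l-1) 1))) *
      I (U ^ (i + j + (l+m-2) + 2) * (J (k-1) (2*i+2*j) 0 * J (n-1) (2*l+2*m) 0)) := by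
  rw [tet_integral _ (LH i * (C 1 * J (l-2) 1 1))
    (U ^ (i + (l-2) + 1) * (H j (2*i) * J (m-1) (2*l-1) 1)) 0 0 0 0
    (U ^ (i + j + (l+m-2) + 2) * (J (k-1) (2*i+2*j) 0 * J (n-1) (2*l+2*m) 0))]
  · simp [I_zero]
  · intro q hq
    obtain ⟨h1, h2, h3⟩ := id hq
    simp only [dot3, vtTetIII, btTetIII, eta_Ph q hq, chi_Ph q hq,
      show (Ph q).2.2 = q.2.2 from rfl,
      legendreP, P_eq _ _ _ _ h1, P_eq _ _ _ _ h2, P_eq _ _ _ _ h3, LH_eq i hi _ h1,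
      H_eq j (2*i) hj (by omega) _ h2,
      eval_mul, eval_pow, U_eval, eval_zero, eval_C]
    ring

lemma eta_raw (hi : 2 ≤ i) (hl : 2 ≤ l) : ((l:ℝ) + 1) * I (J (i-1) 0 0 * J (l-1) 1 1) =
    (l:ℝ) * I (J (i-2) 0 0 * J (l-2) 1 1) := by
  obtain ⟨i, rfl⟩ : ∃ k, i = k + 2 := ⟨i - 2, by omega⟩
  obtain ⟨l, rfl⟩ : ∃ k, l = k + 2 := ⟨l - 2, by omega⟩
  have := eta_id i l
  rw [show i + 2 - 1 = i + 1 by omega, show l + 2 - 1 = l + 1 by omega, Nat.add_sub_cancel,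
    Nat.add_sub_cancel]
  push_cast
  linarith

lemma val_I_II (hi : 2 ≤ i) (hl : 2 ≤ l) (hj : 1 ≤ j) (hk : 1 ≤ k) (hm : 1 ≤ m) (hn : 1 ≤ n) :
    ∫ p in Tet, dot3 (vtTetI i j k p) (btTetII l m n p) = 0 := by
  rw [tet_integral _
    (C ((l:ℝ) + 1) * (J (i-1) 0 0 * J (l-1) 1 1))
    (U ^ ((i-1) + (l-1) + 1) * (H j (2*i) * J (m-1) (2*l) 0))
    (C (-(l:ℝ)) * (J (i-2) 0 0 * J (l-2) 1 1))
    (U ^ ((i-1) + (l-1) + 1) * (H j (2*i) * J (m-1) (2*l) 0)) 0 0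
    (U ^ ((i-1) + j + (l+m-2) + 2) * (H k (2*i+2*j) * J (n-1) (2*l+2*m-1) 1))]
  · rw [I_Cmul, I_Cmul, eta_raw i l hi hl]
    simp [I_zero]
  · intro q hq
    obtain ⟨h1, h2, h3⟩ := id hq
    simp only [dot3, vtTetI, btTetII, eta_Ph q hq, chi_Ph q hq, show (Ph q).2.2 = q.2.2 from rfl,
      legendreP, P_eq _ _ _ _ h1, P_eq _ _ _ _ h2, P_eq _ _ _ _ h3,
      H_eq j (2*i) hj (by omega) _ h2, H_eq k (2*i+2*j) hk (by omega) _ h3,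
      eval_mul, eval_pow, U_eval, eval_zero, eval_C]
    ring

lemma val_I_III (hi : 2 ≤ i) (hl : 2 ≤ l) (hj : 1 ≤ j) (hk : 1 ≤ k) (hm : 1 ≤ m) (hn : 1 ≤ n) :
    ∫ p in Tet, dot3 (vtTetI i j k p) (btTetIII l m n p) = 0 := by
  rw [tet_integral _
    (C (-(((l:ℝ) + 1) / (2 * (l:ℝ)))) * (J (i-1) 0 0 * J (l-1) 1 1))
    (U ^ ((i-1) + (l-1) + 1) * (H j (2*i) * Q1 l m))
    (C (1/2) * (J (i-2) 0 0 * J (l-2) 1 1))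
    (U ^ ((i-1) + (l-2) + 1) * (H j (2*i) * Q2 l m))
    (C (1/4) * (J (i-2) 0 0 * J (l-2) 1 1))
    (U ^ ((i-1) + (l-2) + 1) * (H j (2*i) * J (m-1) (2*l-1) 1))
    (U ^ ((i-1) + j + (l+m-2) + 2) * (H k (2*i+2*j) * J (n-1) (2*l+2*m) 0))]
  · have hl0 : (l:ℝ) ≠ 0 := by positivity
    have hz : I (C (-1/2) * (U ^ ((i-1) + (l-1) + 1) * (H j (2*i) * Q1 l m)) +
        C (1/2) * (U ^ ((i-1) + (l-2) + 1) * (H j (2*i) * Q2 l m)) +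
        C (1/4) * (U ^ ((i-1) + (l-2) + 1) * (H j (2*i) * J (m-1) (2*l-1) 1))) = 0 := by
      convert I_zero
      rw [show (i-1) + (l-1) + 1 = ((i-1) + (l-2) + 1) + 1 by omega, pow_succ]
      apply Polynomial.funext
      intro x
      simp only [Q1, Q2, eval_mul, eval_add, eval_pow, U_eval, eval_C, eval_X, eval_zero]
      ring
    rw [I_add, I_add, I_Cmul, I_Cmul, I_Cmul] at hz
    have he := eta_raw i l hi hl
    have he' : -(((l:ℝ) + 1) / (2 * (l:ℝ))) * I (J (i-1) 0 0 * J (l-1) 1 1) =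
        (-1/2) * I (J (i-2) 0 0 * J (l-2) 1 1) := by
      field_simp
      linarith
    rw [I_Cmul, I_Cmul, I_Cmul, he']
    refine mul_eq_zero_of_left ?_ _
    linear_combination I (J (i-2) 0 0 * J (l-2) 1 1) * hz
  · intro q hq
    obtain ⟨h1, h2, h3⟩ := id hq
    simp only [dot3, vtTetI, btTetIII, eta_Ph q hq, chi_Ph q hq, show (Ph q).2.2 = q.2.2 from rfl,
      legendreP, Qtet1, Qtet2, Q1, Q2, P_eq _ _ _ _ h1, P_eq _ _ _ _ h2, P_eq _ _ _ _ h3,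
      H_eq j (2*i) hj (by omega) _ h2, H_eq k (2*i+2*j) hk (by omega) _ h3,
      eval_mul, eval_pow, U_eval, eval_zero, eval_C, eval_add, eval_X]
    ring

lemma chi_II_III (hl : 2 ≤ l) (hj : 1 ≤ j) (hm : 1 ≤ m) :
    I (U ^ (l + (l-2) + 1) * (J (j-1) (2*l) 0 * Q2 l m)) +
    I (U ^ (l + (l-2) + 1) * ((C (1/2) * X * J (j-1) (2*l) 0 - C ((j:ℝ)/2) * H j (2*l))
      * J (m-1) (2*l-1) 1)) = 0 := by
  obtain ⟨l, rfl⟩ : ∃ k, l = k + 2 := ⟨l - 2, by omega⟩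
  obtain ⟨m, rfl⟩ : ∃ k, m = k + 1 := ⟨m - 1, by omega⟩
  obtain ⟨j, rfl⟩ : ∃ k, j = k + 1 := ⟨j - 1, by omega⟩
  have hj0 : (j:ℝ) + 1 ≠ 0 := by positivity
  rw [← I_add, H, Q2]
  simp only [show l + 2 + (l + 2 - 2) + 1 = 2 * l + 3 by omega,
    show 2 * (l + 2) - 1 = 2 * l + 3 by omega, show m + 1 - 1 = m by omega,
    show j + 1 - 1 = j by omega]
  rw [show 2 * (l + 2) = 2 * l + 3 + 1 by ring]
  push_cast
  rw [show U ^ (2 * l + 3) * (J j (2 * l + 3 + 1) 0 * (C (-1 / 2) * X * J m (2 * l + 3) 1 +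
      C (((m:ℝ) + 1) / (2 * ((l:ℝ) + 2) + ((m:ℝ) + 1) - 1)) * U * J m (2 * l + 3 + 1) 0)) +
    U ^ (2 * l + 3) * ((C (1/2) * X * J j (2 * l + 3 + 1) 0 - C (((j:ℝ) + 1)/2) *
      (C (1 / ((j:ℝ) + 1)) * ((1 + X) * J j (2 * l + 3) 1))) * J m (2 * l + 3) 1) =
    C ((1/2) ^ (2 * l + 3) / 2) * (C (((m:ℝ) + 1) / (2 * ((l:ℝ) + 2) + ((m:ℝ) + 1) - 1)) *
      (Wt (2 * l + 3 + 1) 0 * J j (2 * l + 3 + 1) 0 * J m (2 * l + 3 + 1) 0) -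
      Wt (2 * l + 3) 1 * J j (2 * l + 3) 1 * J m (2 * l + 3) 1) from ?_]
  · rw [I_Cmul, I_sub, I_Cmul]
    refine mul_eq_zero_of_right _ ?_
    by_cases h : j = m
    · subst h
      have := norm_rel j (2 * l + 3)
      push_cast at this
      have h3 : 2 * ((l:ℝ) + 2) + ((j:ℝ) + 1) - 1 = (j:ℝ) + (2 * l + 3) + 1 := by ring
      have h4 : (j:ℝ) + (2 * l + 3) + 1 ≠ 0 := by positivity
      rw [h3, div_mul_eq_mul_div, this, mul_div_cancel_left₀ _ h4, sub_self]
    · rw [orth _ _ _ _ h, orth _ _ _ _ h]; simp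
  · rw [U_pow, Wt_one, Wt_succ_left (2 * l + 3) 0]
    apply Polynomial.funext
    intro x
    simp only [eval_mul, eval_add, eval_sub, U_eval, eval_C, eval_X, eval_one]
    field_simp
    ring

lemma val_II_III (hi : 2 ≤ i) (hl : 2 ≤ l) (hj : 1 ≤ j) (hk : 1 ≤ k) (hm : 1 ≤ m) (hn : 1 ≤ n) :
    ∫ p in Tet, dot3 (vtTetII i j k p) (btTetIII l m n p) = 0 := by
  rw [tet_integral _ 0 0
    (LH i * (C 1 * J (l-2) 1 1))
    (U ^ (i + (l-2) + 1) * (J (j-1) (2*i) 0 * Q2 l m))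
    (LH i * (C 1 * J (l-2) 1 1))
    (U ^ (i + (l-2) + 1) * ((C (1/2) * X * J (j-1) (2*i) 0 - C ((j:ℝ)/2) * H j (2*i))
      * J (m-1) (2*l-1) 1))
    (U ^ ((j-1) + i + (l+m-2) + 2) * (H k (2*i+2*j) * J (n-1) (2*l+2*m) 0))]
  · refine mul_eq_zero_of_left ?_ _
    by_cases h : i = l
    · subst h
      have := chi_II_III j i m hl hj hm
      rw [add_assoc, ← mul_add, this]
      simp [I_zero]
    · rw [(eta2 i l hi hl 1 one_ne_zero).mpr h]
      simp [I_zero]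
  · intro q hq
    obtain ⟨h1, h2, h3⟩ := id hq
    simp only [dot3, vtTetII, btTetIII, eta_Ph q hq, chi_Ph q hq, show (Ph q).2.2 = q.2.2 from rfl,
      legendreP, Qtet2, Q2, P_eq _ _ _ _ h1, P_eq _ _ _ _ h2, P_eq _ _ _ _ h3,
      LH_eq i hi _ h1,
      H_eq j (2*i) hj (by omega) _ h2, H_eq k (2*i+2*j) hk (by omega) _ h3,
      eval_mul, eval_pow, U_eval, eval_zero, eval_C, eval_add, eval_sub, eval_X]
    ring

lemma prod_iff (a b c : ℝ) (p q r : Prop) (ha : a = 0 ↔ ¬ p) (hb : p → (b = 0 ↔ ¬ q))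
    (hc : p → q → (c = 0 ↔ ¬ r)) : a * b * c = 0 ↔ ¬ (p ∧ q ∧ r) := by
  rw [mul_eq_zero, mul_eq_zero]
  tauto

lemma diag (ω : TetType) (hi : 2 ≤ i) (hl : 2 ≤ l) (hj : 1 ≤ j) (hk : 1 ≤ k) (hm : 1 ≤ m)
    (hn : 1 ≤ n) :
    ∫ p in Tet, dot3 (vtTet ω i j k p) (btTet ω l m n p) = 0 ↔ ¬ (i = l ∧ j = m ∧ k = n) := by
  have hl0 : (-2 * (l:ℝ)) ≠ 0 := by
    have : (l:ℝ) ≠ 0 := by positivity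
    simpa using this
  cases ω with
  | I =>
    refine (Eq.congr_left (val_I_I i j k l m n hi hl hj hk hm hn)).trans ?_
    apply prod_iff
    · exact eta1 i l hi hl
    · rintro rfl
      exact hatI _ _ _ _ hj hm (by omega)
    · rintro rfl rfl
      exact hatI _ _ _ _ hk hn (by omega)
  | II =>
    refine (Eq.congr_left (val_II_II i j k l m n hi hl hj hk hm hn)).trans ?_
    apply prod_iff
    · exact eta2 i l hi hl _ hl0
    · rintro rfl
      exact hatII _ _ _ _ hj hm (by omega)
    · rintro rfl rfl
      exact hatI _ _ _ _ hk hn (by omega)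
  | III =>
    refine (Eq.congr_left (val_III_III i j k l m n hi hl hj hk hm hn)).trans ?_
    apply prod_iff
    · exact eta2 i l hi hl _ one_ne_zero
    · rintro rfl
      exact hatI _ _ _ _ hj hm (by omega)
    · rintro rfl rfl
      exact hatII _ _ _ _ hk hn (by omega)

end vals
end TetAux

/-- Biorthogonality of the auxiliary `H(curl)` fields on the tetrahedron and the
dual candidates `b̃^I`, `b̃^II`, `b̃^III`. -/
theorem tetrahedron_Hcurl_aux_biorthogonal :
    (∀ (ω₁ ω₂ : TetType) (i j k l m n : ℕ), 2 ≤ i → 2 ≤ l → 1 ≤ j → 1 ≤ k →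
      1 ≤ m → 1 ≤ n → (i, j, k, ω₁) ≠ (l, m, n, ω₂) →
      ∫ p in Tet, dot3 (vtTet ω₁ i j k p) (btTet ω₂ l m n p) = 0) ∧
    (∀ (ω : TetType) (l m n : ℕ), 2 ≤ l → 1 ≤ m → 1 ≤ n →
      (∫ p in Tet, dot3 (vtTet ω l m n p) (btTet ω l m n p)) ≠ 0) := by
  refine ⟨?_, ?_⟩
  · intro ω₁ ω₂ i j k l m n hi hl hj hk hm hn hne
    by_cases h : ω₁ = ω₂
    · subst h
      rw [TetAux.diag i j k l m n ω₁ hi hl hj hk hm hn]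
      rintro ⟨rfl, rfl, rfl⟩
      exact hne rfl
    · cases ω₁ <;> cases ω₂
      · exact absurd rfl h
      · exact TetAux.val_I_II i j k l m n hi hl hj hk hm hn
      · exact TetAux.val_I_III i j k l m n hi hl hj hk hm hn
      · simp [vtTet, btTet, vtTetII, btTetI, dot3]
      · exact absurd rfl h
      · exact TetAux.val_II_III i j k l m n hi hl hj hk hm hn
      · simp [vtTet, btTet, vtTetIII, btTetI, dot3]
      · simp [vtTet, btTet, vtTetIII, btTetII, dot3]
      · exact absurd rfl h
  · intro ω l m n hl hm hn h
    exact (TetAux.diag l m n l m n ω hl hl hm hn hm hn).mp h ⟨rfl, rfl, rfl⟩
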